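/- Let X = {1, 3, 5, 8, 10, 11, 13} ⊂ ℝ with the metric d(x,y) = |x − y|, let N_p = 2, and let C be the 2-clustering {{1, 3, 5}, {8, 10, 11, 13}}. Then C is weakly separable for N_p = 2, but C is not strongly separable for N_p = 2. (Hence weak separability does not imply strong separability.) -/

import Mathlib

variable {α : Type*}

/-- Sparsity ε_{N_p}(x): smallest ε ≥ 0 such that at least N_p points of X lie within
distance ε of x. -/
noncomputable def sparsity [MetricSpace α] (X : Finset α) (Np : ℕ) (x : α) : ℝ :=
  sInf {ε : ℝ | 0 ≤ ε ∧ Np ≤ (X.filter (fun y => dist x y ≤ ε)).card}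

/-- x is ε-connected to y: there is a finite sequence of points of X from x to y,
each of sparsity at most ε, with consecutive distances at most ε. -/
def EpsConn [MetricSpace α] (X : Finset α) (Np : ℕ) (ε : ℝ) (x y : α) : Prop :=
  x ∈ X ∧ sparsity X Np x ≤ ε ∧
    Relation.ReflTransGen (fun a b => b ∈ X ∧ sparsity X Np b ≤ ε ∧ dist a b ≤ ε) x y

/-- A set c is ε-connected if every pair of points of c is ε-connected. -/
def SetConn [MetricSpace α] (X : Finset α) (Np : ℕ) (ε : ℝ) (c : Finset α) : Prop :=
  ∀ x ∈ c, ∀ y ∈ c, EpsConn X Np ε x y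

/-- ε*(c): the minimum ε such that c is ε-connected. -/
noncomputable def setSparsity [MetricSpace α] (X : Finset α) (Np : ℕ) (c : Finset α) : ℝ :=
  sInf {ε : ℝ | SetConn X Np ε c}

/-- ε(x,y): the minimum ε such that x is ε-connected to y. -/
noncomputable def epsDist [MetricSpace α] (X : Finset α) (Np : ℕ) (x y : α) : ℝ :=
  sInf {ε : ℝ | EpsConn X Np ε x y}

/-- ε(x,c): min over y ∈ c of ε(x,y). -/
noncomputable def ptClusterDist [MetricSpace α] (X : Finset α) (Np : ℕ) (x : α)
    (c : Finset α) : ℝ :=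
  sInf {e : ℝ | ∃ y ∈ c, e = epsDist X Np x y}

/-- ε(c,c'): min over x ∈ c, y ∈ c' of ε(x,y). -/
noncomputable def clusterDist [MetricSpace α] (X : Finset α) (Np : ℕ)
    (c c' : Finset α) : ℝ :=
  sInf {e : ℝ | ∃ x ∈ c, ∃ y ∈ c', e = epsDist X Np x y}

/-- A clustering of X: a partition of X into nonempty clusters. -/
def IsClustering (X : Finset α) (C : Finset (Finset α)) : Prop :=
  (∀ c ∈ C, c.Nonempty) ∧ (∀ c ∈ C, ∀ c' ∈ C, c ≠ c' → Disjoint c c') ∧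
    (∀ c ∈ C, c ⊆ X) ∧ (∀ x ∈ X, ∃ c ∈ C, x ∈ c)

/-- C is weakly separable: for each cluster c, ε*(c) < min over c' ≠ c of ε(c,c'). -/
def WeaklySeparable [MetricSpace α] (X : Finset α) (Np : ℕ) (C : Finset (Finset α)) : Prop :=
  ∀ c ∈ C, ∀ c' ∈ C, c' ≠ c → setSparsity X Np c < clusterDist X Np c c'

/-- c is an ε-cluster: a (nonempty) maximal ε-connected subset of X. -/
def IsEpsCluster [MetricSpace α] (X : Finset α) (Np : ℕ) (ε : ℝ) (c : Finset α) : Prop :=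
  c.Nonempty ∧ SetConn X Np ε c ∧ ∀ x ∈ X, (∃ y ∈ c, EpsConn X Np ε x y) → x ∈ c

/-- c is a maximal cluster: an ε-cluster for some ε ≥ 0. -/
def IsMaximalCluster [MetricSpace α] (X : Finset α) (Np : ℕ) (c : Finset α) : Prop :=
  ∃ ε : ℝ, 0 ≤ ε ∧ IsEpsCluster X Np ε c

/-- x is a local maximum: every y ∈ X with d(x,y) ≤ ε_{N_p}(x) has sparsity ≥ that of x. -/
def IsLocalMaxPt [MetricSpace α] (X : Finset α) (Np : ℕ) (x : α) : Prop :=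
  x ∈ X ∧ ∀ y ∈ X, dist x y ≤ sparsity X Np x → sparsity X Np x ≤ sparsity X Np y

/-- X_c*: the points of c of minimum sparsity within c. -/
noncomputable def minSparsityPts [MetricSpace α] (X : Finset α) (Np : ℕ)
    (c : Finset α) : Finset α :=
  c.filter (fun x => ∀ y ∈ c, sparsity X Np x ≤ sparsity X Np y)

/-- Relative separability A(x,y) = ε(x,y) / ε_{N_p}(x). -/
noncomputable def relSep [MetricSpace α] (X : Finset α) (Np : ℕ) (x y : α) : ℝ :=
  epsDist X Np x y / sparsity X Np x

/-- A(x,c) = min over y ∈ c of A(x,y). -/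
noncomputable def relSepCluster [MetricSpace α] (X : Finset α) (Np : ℕ) (x : α)
    (c : Finset α) : ℝ :=
  sInf {a : ℝ | ∃ y ∈ c, a = relSep X Np x y}

/-- A^ℓ(C): the minimum A such that for every local maximum x, every y in the cluster of x
with sparsity at most that of x satisfies A(x,y) ≤ A. -/
noncomputable def Aell [MetricSpace α] (X : Finset α) (Np : ℕ)
    (C : Finset (Finset α)) : ℝ :=
  sInf {A : ℝ | ∀ x ∈ X, IsLocalMaxPt X Np x → ∀ c ∈ C, x ∈ c →
    ∀ y ∈ c, sparsity X Np y ≤ sparsity X Np x → relSep X Np x y ≤ A}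

/-- C is LM-separable: A^ℓ(C) < min over distinct clusters c, c' and z ∈ X_c* of A(z,c'). -/
def LMSeparable [MetricSpace α] (X : Finset α) (Np : ℕ) (C : Finset (Finset α)) : Prop :=
  ∀ c ∈ C, ∀ c' ∈ C, c ≠ c' → ∀ z ∈ minSparsityPts X Np c,
    Aell X Np C < relSepCluster X Np z c'

/-- min over x ∈ c of ε_{N_p}(x). -/
noncomputable def minSpars [MetricSpace α] (X : Finset α) (Np : ℕ) (c : Finset α) : ℝ :=
  sInf (sparsity X Np '' (c : Set α))

/-- max over x ∈ c of ε_{N_p}(x). -/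
noncomputable def maxSpars [MetricSpace α] (X : Finset α) (Np : ℕ) (c : Finset α) : ℝ :=
  sSup (sparsity X Np '' (c : Set α))

/-- C is strongly separable: there is an A such that each cluster c is
(A · min sparsity of c)-connected and A · min sparsity of c < min over c' ≠ c of ε(c,c'). -/
def StronglySeparable [MetricSpace α] (X : Finset α) (Np : ℕ)
    (C : Finset (Finset α)) : Prop :=
  ∃ A : ℝ, ∀ c ∈ C, SetConn X Np (A * minSpars X Np c) c ∧
    ∀ c' ∈ C, c' ≠ c → A * minSpars X Np c < clusterDist X Np c c'

/-- c*(x,ε): the set of points of X that are ε-connected to x. -/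
def epsClusterAt [MetricSpace α] (X : Finset α) (Np : ℕ) (ε : ℝ) (x : α) : Set α :=
  {y | EpsConn X Np ε x y}

section Auxiliary

variable {β : Type*} [MetricSpace β] {X : Finset β}

/-- For `Np = 2` the sparsity is the distance to a nearest neighbour. -/
theorem sparsity_two_eq {x y : β} (hx : x ∈ X) (hy : y ∈ X) (hne : y ≠ x)
    (hmin : ∀ z ∈ X, z ≠ x → dist x y ≤ dist x z) : sparsity X 2 x = dist x y := by
  refine IsLeast.csInf_eq ⟨⟨dist_nonneg, ?_⟩, ?_⟩
  · refine Finset.one_lt_card.2 ⟨x, ?_, y, ?_, hne.symm⟩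
    · simp [hx]
    · simp [hy]
  · rintro ε ⟨-, hcard⟩
    obtain ⟨z, hz, hzx⟩ := Finset.exists_mem_ne (show 1 < _ from hcard) x
    rw [Finset.mem_filter] at hz
    exact (hmin z hz.1 hzx).trans hz.2

theorem sparsity_nonneg (Np : ℕ) (x : β) : 0 ≤ sparsity X Np x :=
  Real.sInf_nonneg fun _ h => h.1

theorem bddBelow_epsConn (Np : ℕ) (x y : β) : BddBelow {ε : ℝ | EpsConn X Np ε x y} :=
  ⟨sparsity X Np x, fun _ h => h.2.1⟩

theorem epsDist_le {Np : ℕ} {ε : ℝ} {x y : β} (h : EpsConn X Np ε x y) :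
    epsDist X Np x y ≤ ε :=
  csInf_le (bddBelow_epsConn Np x y) h

theorem epsDist_nonneg (Np : ℕ) (x y : β) : 0 ≤ epsDist X Np x y :=
  Real.sInf_nonneg fun _ h => (sparsity_nonneg Np x).trans h.2.1

theorem clusterDist_le {Np : ℕ} {ε : ℝ} {c c' : Finset β} {x y : β} (hx : x ∈ c) (hy : y ∈ c')
    (h : EpsConn X Np ε x y) : clusterDist X Np c c' ≤ ε := by
  refine le_trans ?_ (epsDist_le h)
  refine csInf_le ⟨0, ?_⟩ ⟨x, hx, y, hy, rfl⟩
  rintro _ ⟨a, -, b, -, rfl⟩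
  exact epsDist_nonneg Np a b

theorem setSparsity_le {Np : ℕ} {ε : ℝ} {c : Finset β} (hc : c.Nonempty)
    (h : SetConn X Np ε c) : setSparsity X Np c ≤ ε := by
  obtain ⟨x, hx⟩ := hc
  exact csInf_le ⟨sparsity X Np x, fun _ h => (h x hx x hx).2.1⟩ h

/-- Points of `X` are connected at any scale bounding their sparsities and distance. -/
theorem EpsConn.of_dist_le {Np : ℕ} {ε : ℝ} {x y : β} (hx : x ∈ X) (hy : y ∈ X)
    (hsx : sparsity X Np x ≤ ε) (hsy : sparsity X Np y ≤ ε) (hd : dist x y ≤ ε) :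
    EpsConn X Np ε x y :=
  ⟨hx, hsx, .single ⟨hy, hsy, hd⟩⟩

theorem EpsConn.trans {Np : ℕ} {ε : ℝ} {x y z : β} (hxy : EpsConn X Np ε x y)
    (hyz : EpsConn X Np ε y z) : EpsConn X Np ε x z :=
  ⟨hxy.1, hxy.2.1, hxy.2.2.trans hyz.2.2⟩

/-- A cluster at distance at least `r` from the rest of `X` has `ε`-distance at least `r` from
every cluster disjoint from it. -/
theorem le_clusterDist {Np : ℕ} {r : ℝ} {c c' : Finset β} (hcX : c ⊆ X) (hcX' : c' ⊆ X)
    (hc : c.Nonempty) (hc' : c'.Nonempty) (hdisj : Disjoint c c')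
    (hr : ∀ x ∈ c, ∀ y ∈ X, y ∉ c → r ≤ dist x y) : r ≤ clusterDist X Np c c' := by
  obtain ⟨a, ha⟩ := hc
  obtain ⟨b, hb⟩ := hc'
  refine le_csInf ⟨_, a, ha, b, hb, rfl⟩ ?_
  rintro _ ⟨x, hx, y, hy, rfl⟩
  refine le_csInf ⟨max (max (sparsity X Np x) (sparsity X Np y)) (dist x y), ?_⟩ ?_
  · exact .of_dist_le (hcX hx) (hcX' hy) (by simp) (by simp) (by simp)
  · rintro ε ⟨-, -, hpath⟩
    by_contra! hlt
    refine Finset.disjoint_left.1 hdisj ?_ hy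
    clear hy
    induction hpath with
    | refl => exact hx
    | tail _ hstep ih =>
      by_contra hmem
      exact absurd (hr _ ih _ hstep.1 hmem) (not_le.2 (hstep.2.2.trans_lt hlt))

end Auxiliary

/-- The example point set. -/
local notation "X₀" => ({1, 3, 5, 8, 10, 11, 13} : Finset ℝ)

theorem sparsity_example {x y s : ℝ} (hx : x ∈ X₀) (hy : y ∈ X₀) (hs : |x - y| = s)
    (hpos : 0 < s) (hmin : ∀ z ∈ X₀, z ≠ x → s ≤ |x - z|) : sparsity X₀ 2 x = s := by
  rw [← hs, ← Real.dist_eq]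
  refine sparsity_two_eq hx hy ?_ ?_
  · rintro rfl
    simp at hs
    linarith
  · simpa only [Real.dist_eq, hs] using hmin

theorem sparsity_example_values :
    sparsity X₀ 2 1 = 2 ∧ sparsity X₀ 2 3 = 2 ∧ sparsity X₀ 2 5 = 2 ∧ sparsity X₀ 2 8 = 2 ∧
      sparsity X₀ 2 10 = 1 ∧ sparsity X₀ 2 11 = 1 ∧ sparsity X₀ 2 13 = 2 := by
  refine ⟨sparsity_example (y := 3) ?_ ?_ ?_ ?_ ?_, sparsity_example (y := 5) ?_ ?_ ?_ ?_ ?_,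
    sparsity_example (y := 3) ?_ ?_ ?_ ?_ ?_, sparsity_example (y := 10) ?_ ?_ ?_ ?_ ?_,
    sparsity_example (y := 11) ?_ ?_ ?_ ?_ ?_, sparsity_example (y := 10) ?_ ?_ ?_ ?_ ?_,
    sparsity_example (y := 11) ?_ ?_ ?_ ?_ ?_⟩
  all_goals norm_num [abs_of_pos, abs_of_neg]

theorem sparsity_example_le {x : ℝ} (hx : x ∈ X₀) : sparsity X₀ 2 x ≤ 2 := by
  obtain ⟨h1, h3, h5, h8, h10, h11, h13⟩ := sparsity_example_values
  simp only [Finset.mem_insert, Finset.mem_singleton] at hx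
  rcases hx with rfl | rfl | rfl | rfl | rfl | rfl | rfl <;> linarith

theorem epsConn_example {ε x y : ℝ} (hε : 2 ≤ ε) (hx : x ∈ X₀) (hy : y ∈ X₀)
    (hd : |x - y| ≤ ε) : EpsConn X₀ 2 ε x y :=
  .of_dist_le hx hy ((sparsity_example_le hx).trans hε) ((sparsity_example_le hy).trans hε)
    (by rwa [Real.dist_eq])

theorem setConn_example_left : SetConn X₀ 2 2 {1, 3, 5} := by
  intro x hx y hy
  simp only [Finset.mem_insert, Finset.mem_singleton] at hx hy
  refine EpsConn.trans (y := 3) ?_ ?_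
  · rcases hx with rfl | rfl | rfl <;> apply epsConn_example <;> norm_num [abs_of_pos, abs_of_neg]
  · rcases hy with rfl | rfl | rfl <;> apply epsConn_example <;> norm_num [abs_of_pos, abs_of_neg]

theorem setConn_example_right : SetConn X₀ 2 2 {8, 10, 11, 13} := by
  intro x hx y hy
  simp only [Finset.mem_insert, Finset.mem_singleton] at hx hy
  have h1011 : EpsConn X₀ 2 2 10 11 := by
    apply epsConn_example <;> norm_num
  have h1110 : EpsConn X₀ 2 2 11 10 := by
    apply epsConn_example <;> norm_num
  refine EpsConn.trans (y := 10) ?_ ?_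
  · rcases hx with rfl | rfl | rfl | rfl
    on_goal 4 => refine EpsConn.trans ?_ h1110
    all_goals apply epsConn_example <;> norm_num [abs_of_pos, abs_of_neg]
  · rcases hy with rfl | rfl | rfl | rfl
    on_goal 4 => refine h1011.trans ?_
    all_goals apply epsConn_example <;> norm_num [abs_of_pos, abs_of_neg]

/-- the 2-clustering {{1,3,5},{8,10,11,13}} of X = {1,3,5,8,10,11,13} ⊂ ℝ
is weakly separable but not strongly separable for N_p = 2. -/
theorem stmt_13 :
    WeaklySeparable ({1, 3, 5, 8, 10, 11, 13} : Finset ℝ) 2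
      ({({1, 3, 5} : Finset ℝ), ({8, 10, 11, 13} : Finset ℝ)} : Finset (Finset ℝ)) ∧
    ¬ StronglySeparable ({1, 3, 5, 8, 10, 11, 13} : Finset ℝ) 2
      ({({1, 3, 5} : Finset ℝ), ({8, 10, 11, 13} : Finset ℝ)} : Finset (Finset ℝ)) := by
  obtain ⟨h1, h3, h5, h8, h10, h11, h13⟩ := sparsity_example_values
  have hne : ({8, 10, 11, 13} : Finset ℝ) ≠ {1, 3, 5} := fun h => by
    have h8 : (8 : ℝ) ∈ ({1, 3, 5} : Finset ℝ) := h ▸ by simp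
    norm_num at h8
  constructor
  · intro c hc c' hc' hcc'
    simp only [Finset.mem_insert, Finset.mem_singleton] at hc hc'
    have key : setSparsity X₀ 2 c ≤ 2 ∧ 3 ≤ clusterDist X₀ 2 c c' := by
      rcases hc with rfl | rfl <;> rcases hc' with rfl | rfl
      · exact absurd rfl hcc'
      · refine ⟨setSparsity_le (by simp) setConn_example_left, le_clusterDist ?_ ?_ ?_ ?_ ?_ ?_⟩
        all_goals norm_num [Finset.insert_subset_iff, Real.dist_eq, abs_of_pos, abs_of_neg]
      · refine ⟨setSparsity_le (by simp) setConn_example_right, le_clusterDist ?_ ?_ ?_ ?_ ?_ ?_⟩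
        all_goals norm_num [Finset.insert_subset_iff, Real.dist_eq, abs_of_pos, abs_of_neg]
      · exact absurd rfl hcc'
    linarith
  · rintro ⟨A, hA⟩
    have hleft : minSpars X₀ 2 {1, 3, 5} = 2 := by
      simp [minSpars, Set.image_insert_eq, h1, h3, h5]
    have hright : minSpars X₀ 2 {8, 10, 11, 13} = 1 := by
      refine IsLeast.csInf_eq ⟨⟨10, by simp, h10⟩, ?_⟩
      rintro _ ⟨x, hx, rfl⟩
      simp only [Finset.coe_insert, Finset.coe_singleton, Set.mem_insert_iff,
        Set.mem_singleton_iff] at hx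
      rcases hx with rfl | rfl | rfl | rfl <;> linarith
    have hlt := (hA {1, 3, 5} (by simp)).2 {8, 10, 11, 13} (by simp) hne
    have hconn := ((hA {8, 10, 11, 13} (by simp)).1 8 (by simp) 8 (by simp)).2.1
    have hle : clusterDist X₀ 2 {1, 3, 5} {8, 10, 11, 13} ≤ 3 :=
      clusterDist_le (x := 5) (y := 8) (by simp) (by simp)
        (epsConn_example (by norm_num) (by simp) (by simp) (by norm_num [abs_of_neg]))
    rw [hleft] at hlt
    rw [hright, h8] at hconn
    linarith
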